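/- Let X be a variable and e1, e2, e3 expressions, and let g2, g23 be expressions with X ∉ occ(g2) and X ∉ occ(g23) such that μ X = e2 ≡ μ X = g2 and μ X = e2 ∨ e3 ≡ μ X = g23. Then μ X = (e1 → e2 ◇ e3) ≡ μ X = (e1[X := g2] → g2 ◇ g23). -/

import Mathlib

namespace RESpaper

noncomputable section

/-- Addition on the extended reals in which `⊤` (i.e. `∞`) dominates. -/
def eadd (x y : EReal) : EReal := if x = ⊤ ∨ y = ⊤ then ⊤ else x + y

/-- The operator `eq-∞`. -/
def eqNegInfVal (x : EReal) : EReal := if x = ⊥ then ⊥ else ⊤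

/-- The operator `eq∞`. -/
def eqInfVal (x : EReal) : EReal := if x = ⊤ then ⊤ else ⊥

open Classical in
/-- The sum, with respect to `eadd`, of a finite family of extended reals. -/
def eSum {ι : Type*} (s : Finset ι) (e : ι → EReal) : EReal :=
  if ∃ i ∈ s, e i = ⊤ then ⊤ else ∑ i ∈ s, e i

/-- Syntax of expressions over a set `V` of variables. -/
inductive Expr (V : Type*) where
  | var : V → Expr V
  | const : EReal → Expr V
  | scale : {c : ℝ // 0 < c} → Expr V → Expr V
  | add : Expr V → Expr V → Expr V
  | emin : Expr V → Expr V → Expr V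
  | emax : Expr V → Expr V → Expr V
  | condL : Expr V → Expr V → Expr V → Expr V   -- (e₁ ⇒ e₂ ◇ e₃)
  | condR : Expr V → Expr V → Expr V → Expr V   -- (e₁ → e₂ ◇ e₃)
  | eqm : Expr V → Expr V                       -- eq-∞(e)

variable {V : Type*}

/-- Evaluation of an expression under a valuation `η`. -/
def Expr.eval (η : V → EReal) : Expr V → EReal
  | var X => η X
  | const d => d
  | scale c e => (c.1 : EReal) * Expr.eval η e
  | add e₁ e₂ => eadd (Expr.eval η e₁) (Expr.eval η e₂)
  | emin e₁ e₂ => Expr.eval η e₁ ⊓ Expr.eval η e₂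
  | emax e₁ e₂ => Expr.eval η e₁ ⊔ Expr.eval η e₂
  | condL e₁ e₂ e₃ =>
      if Expr.eval η e₁ ≤ 0 then Expr.eval η e₂ ⊓ Expr.eval η e₃ else Expr.eval η e₃
  | condR e₁ e₂ e₃ =>
      if Expr.eval η e₁ < 0 then Expr.eval η e₂ else Expr.eval η e₂ ⊔ Expr.eval η e₃
  | eqm e => eqNegInfVal (Expr.eval η e)

/-- The set of variables occurring in an expression. -/
def Expr.occ : Expr V → Set V
  | var X => {X}
  | const _ => ∅
  | scale _ e => Expr.occ e
  | add e₁ e₂ => Expr.occ e₁ ∪ Expr.occ e₂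
  | emin e₁ e₂ => Expr.occ e₁ ∪ Expr.occ e₂
  | emax e₁ e₂ => Expr.occ e₁ ∪ Expr.occ e₂
  | condL e₁ e₂ e₃ => Expr.occ e₁ ∪ Expr.occ e₂ ∪ Expr.occ e₃
  | condR e₁ e₂ e₃ => Expr.occ e₁ ∪ Expr.occ e₂ ∪ Expr.occ e₃
  | eqm e => Expr.occ e

/-- `e` contains no occurrence of the conditional operators. -/
def Expr.noCond : Expr V → Prop
  | var _ => True
  | const _ => True
  | scale _ e => Expr.noCond e
  | add e₁ e₂ => Expr.noCond e₁ ∧ Expr.noCond e₂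
  | emin e₁ e₂ => Expr.noCond e₁ ∧ Expr.noCond e₂
  | emax e₁ e₂ => Expr.noCond e₁ ∧ Expr.noCond e₂
  | condL _ _ _ => False
  | condR _ _ _ => False
  | eqm e => Expr.noCond e

/-- Syntactic substitution `e[X := g]`. -/
def Expr.subst [DecidableEq V] (X : V) (g : Expr V) : Expr V → Expr V
  | var Y => if Y = X then g else var Y
  | const d => const d
  | scale c e => scale c (Expr.subst X g e)
  | add e₁ e₂ => add (Expr.subst X g e₁) (Expr.subst X g e₂)
  | emin e₁ e₂ => emin (Expr.subst X g e₁) (Expr.subst X g e₂)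
  | emax e₁ e₂ => emax (Expr.subst X g e₁) (Expr.subst X g e₂)
  | condL e₁ e₂ e₃ => condL (Expr.subst X g e₁) (Expr.subst X g e₂) (Expr.subst X g e₃)
  | condR e₁ e₂ e₃ => condR (Expr.subst X g e₁) (Expr.subst X g e₂) (Expr.subst X g e₃)
  | eqm e => eqm (Expr.subst X g e)

/-- `(Σ_{(c,X) ∈ cs} c·X) + rest`. -/
def scaledSum (cs : List ({c : ℝ // 0 < c} × V)) (rest : Expr V) : Expr V :=
  cs.foldr (fun p acc => Expr.add (Expr.scale p.1 (Expr.var p.2)) acc) rest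

/-- `(Σ_{X ∈ ms} eq-∞(X)) + rest`. -/
def eqmSum (ms : List V) (rest : Expr V) : Expr V :=
  ms.foldr (fun X acc => Expr.add (Expr.eqm (Expr.var X)) acc) rest

/-- A term of the shape `(Σ_{X∈𝒳'} c^X·X) + (Σ_{X∈𝒳''} eq-∞(X)) + d`
with the variables in each of the two sums pairwise distinct. -/
def IsSimpleTerm (e : Expr V) : Prop :=
  ∃ (cs : List ({c : ℝ // 0 < c} × V)) (ms : List V) (d : EReal),
    (cs.map Prod.snd).Nodup ∧ ms.Nodup ∧ e = scaledSum cs (eqmSum ms (Expr.const d))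

/-- Finite disjunction; the empty disjunction is `−∞`. -/
def disjList : List (Expr V) → Expr V
  | [] => Expr.const ⊥
  | [e] => e
  | e :: es => Expr.emax e (disjList es)

/-- Finite conjunction; the empty conjunction is `∞`. -/
def conjList : List (Expr V) → Expr V
  | [] => Expr.const ⊤
  | [e] => e
  | e :: es => Expr.emin e (conjList es)

/-- Simple conjunctive normal form. -/
def IsSimpleCNF (e : Expr V) : Prop :=
  ∃ ls : List (List (Expr V)),
    (∀ l ∈ ls, ∀ t ∈ l, IsSimpleTerm t) ∧ e = conjList (ls.map disjList)

/-- Simple disjunctive normal form. -/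
def IsSimpleDNF (e : Expr V) : Prop :=
  ∃ ls : List (List (Expr V)),
    (∀ l ∈ ls, ∀ t ∈ l, IsSimpleTerm t) ∧ e = disjList (ls.map conjList)

/-- Conjunctive normal form. -/
inductive IsCNF : Expr V → Prop where
  | simple {e : Expr V} : IsSimpleCNF e → IsCNF e
  | condL {e₁ e₂ e₃ : Expr V} :
      IsSimpleCNF e₁ → IsCNF e₂ → IsCNF e₃ → IsCNF (Expr.condL e₁ e₂ e₃)
  | condR {e₁ e₂ e₃ : Expr V} :
      IsSimpleCNF e₁ → IsCNF e₂ → IsCNF e₃ → IsCNF (Expr.condR e₁ e₂ e₃)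

/-- Disjunctive normal form. -/
inductive IsDNF : Expr V → Prop where
  | simple {e : Expr V} : IsSimpleDNF e → IsDNF e
  | condL {e₁ e₂ e₃ : Expr V} :
      IsSimpleDNF e₁ → IsDNF e₂ → IsDNF e₃ → IsDNF (Expr.condL e₁ e₂ e₃)
  | condR {e₁ e₂ e₃ : Expr V} :
      IsSimpleDNF e₁ → IsDNF e₂ → IsDNF e₃ → IsDNF (Expr.condR e₁ e₂ e₃)

/-- Fixed-point symbols. -/
inductive FP where
  | mu : FP
  | nu : FP

/-- A real equation system: a finite sequence of fixed-point equations `σ X = e`. -/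
abbrev RES (V : Type*) := List (FP × V × Expr V)

/-- The bound variables of a RES. -/
def bnd (E : RES V) : List V := E.map (fun p => p.2.1)

variable [DecidableEq V]

/-- The solution `[[ℰ]]η` of a real equation system. -/
def sol : RES V → (V → EReal) → V → EReal
  | [], η => η
  | (FP.mu, X, e) :: E, η =>
      sol E (Function.update η X
        (sInf {r : EReal | Expr.eval (sol E (Function.update η X r)) e ≤ r}))
  | (FP.nu, X, e) :: E, η =>
      sol E (Function.update η X
        (sSup {r : EReal | r ≤ Expr.eval (sol E (Function.update η X r)) e}))

/-- Equivalence of real equation systems. -/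
def REquiv (E E' : RES V) : Prop :=
  ∀ F : RES V, (∀ Y ∈ bnd F, Y ∉ bnd E ∧ Y ∉ bnd E') →
    ∀ η : V → EReal, sol (E ++ F) η = sol (E' ++ F) η


theorem eadd_le_eadd {a b c d : EReal} (hac : a ≤ c) (hbd : b ≤ d) : eadd a b ≤ eadd c d := by
  unfold eadd
  by_cases h : c = ⊤ ∨ d = ⊤
  · simp [h]
  · have h' : ¬(a = ⊤ ∨ b = ⊤) := by
      rintro (rfl | rfl)
      · exact h (Or.inl (top_le_iff.mp hac))
      · exact h (Or.inr (top_le_iff.mp hbd))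
    rw [if_neg h, if_neg h']
    exact add_le_add hac hbd

theorem eqNegInfVal_mono : Monotone eqNegInfVal := by
  intro a b hab
  unfold eqNegInfVal
  by_cases hb : b = ⊥
  · have ha : a = ⊥ := le_bot_iff.mp (hb ▸ hab)
    simp [ha, hb]
  · simp [hb]

theorem Expr.eval_mono {W : Type*} (e : Expr W) : Monotone fun η : W → EReal => Expr.eval η e := by
  intro η θ h
  induction e with
  | var X => exact h X
  | const d => exact le_rfl
  | scale c e ih =>
    exact mul_le_mul_of_nonneg_left ih (EReal.coe_nonneg.mpr c.2.le)
  | add e₁ e₂ ih₁ ih₂ => exact eadd_le_eadd ih₁ ih₂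
  | emin e₁ e₂ ih₁ ih₂ => exact inf_le_inf ih₁ ih₂
  | emax e₁ e₂ ih₁ ih₂ => exact sup_le_sup ih₁ ih₂
  | condL e₁ e₂ e₃ ih₁ ih₂ ih₃ =>
    simp only [Expr.eval] at *
    split_ifs with ha hb
    · exact inf_le_inf ih₂ ih₃
    · exact inf_le_right.trans ih₃
    · exact absurd (ih₁.trans ‹_›) ha
    · exact ih₃
  | condR e₁ e₂ e₃ ih₁ ih₂ ih₃ =>
    simp only [Expr.eval] at *
    split_ifs with ha hb
    · exact ih₂
    · exact ih₂.trans le_sup_left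
    · exact absurd (ih₁.trans_lt ‹_›) ha
    · exact sup_le_sup ih₂ ih₃
  | eqm e ih => exact eqNegInfVal_mono ih

theorem Expr.eval_update_of_notMem_occ {X : V} {e : Expr V} (h : X ∉ e.occ)
    (η : V → EReal) (r : EReal) :
    Expr.eval (Function.update η X r) e = Expr.eval η e := by
  induction e with
  | var Y => exact Function.update_of_ne (fun hY => h hY.symm) _ _
  | const d => rfl
  | _ => simp_all [Expr.eval, Expr.occ]

theorem Expr.eval_subst (X : V) (g e : Expr V) (η : V → EReal) :
    Expr.eval η (Expr.subst X g e) = Expr.eval (Function.update η X (Expr.eval η g)) e := by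
  induction e with
  | var Y =>
    by_cases h : Y = X
    · subst h; simp [Expr.subst, Expr.eval]
    · simp [Expr.subst, Expr.eval, h]
  | const d => rfl
  | _ => simp_all [Expr.eval, Expr.subst]

theorem sol_mono (E : RES V) : Monotone (sol E) := by
  induction E with
  | nil => exact monotone_id
  | cons p E ih =>
    obtain ⟨σ, X, e⟩ := p
    intro η θ h
    have key : ∀ r, Expr.eval (sol E (Function.update η X r)) e
        ≤ Expr.eval (sol E (Function.update θ X r)) e := fun r =>
      Expr.eval_mono e (ih (update_le_update_iff.mpr ⟨le_rfl, fun Y _ => h Y⟩))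
    cases σ with
    | mu =>
      refine ih (update_le_update_iff.mpr ⟨?_, fun Y _ => h Y⟩)
      exact sInf_le_sInf fun r hr => (key r).trans hr
    | nu =>
      refine ih (update_le_update_iff.mpr ⟨?_, fun Y _ => h Y⟩)
      exact sSup_le_sSup fun r hr => le_trans hr (key r)

theorem sol_of_notMem_bnd {E : RES V} {X : V} (h : X ∉ bnd E) (η : V → EReal) :
    sol E η X = η X := by
  induction E generalizing η with
  | nil => rfl
  | cons p E ih =>
    obtain ⟨σ, Y, e⟩ := p
    simp only [bnd, List.map_cons, List.mem_cons, not_or] at h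
    cases σ <;> exact (ih h.2 _).trans (Function.update_of_ne h.1 _ _)

/-- The map `r ↦ [[E]](η[X := r])(e)` whose extremal fixed points define `sol`. -/
def stepHom (E : RES V) (η : V → EReal) (X : V) (e : Expr V) :
    EReal →o EReal where
  toFun r := Expr.eval (sol E (Function.update η X r)) e
  monotone' _ _ h := Expr.eval_mono e (sol_mono E (Function.update_mono h))

theorem stepHom_apply (E : RES V) (η : V → EReal) (X : V) (e : Expr V) (r : EReal) :
    stepHom E η X e r = Expr.eval (sol E (Function.update η X r)) e :=
  rfl

theorem sol_mu_cons (E : RES V) (η : V → EReal) (X : V) (e : Expr V) :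
    sol ((FP.mu, X, e) :: E) η = sol E (Function.update η X (OrderHom.lfp (stepHom E η X e))) :=
  rfl

theorem REquiv.lfp_stepHom_eq {X : V} {e g : Expr V}
    (h : REquiv [(FP.mu, X, e)] [(FP.mu, X, g)]) {E : RES V} (hX : X ∉ bnd E) (η : V → EReal) :
    OrderHom.lfp (stepHom E η X e) = OrderHom.lfp (stepHom E η X g) := by
  have hE : ∀ Y ∈ bnd E, Y ∉ bnd [(FP.mu, X, e)] ∧ Y ∉ bnd [(FP.mu, X, g)] := by
    intro Y hY
    have : Y ≠ X := fun hYX => hX (hYX ▸ hY)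
    simp [bnd, this]
  have := congrFun (h E hE η) X
  simpa only [List.singleton_append, sol_mu_cons, sol_of_notMem_bnd hX, Function.update_self]
    using this

theorem REquiv.eval_le {X : V} {e g : Expr V}
    (h : REquiv [(FP.mu, X, e)] [(FP.mu, X, g)]) (hg : X ∉ g.occ) {θ : V → EReal}
    (he : Expr.eval θ e ≤ θ X) : Expr.eval θ g ≤ θ X := by
  have hlfp := h.lfp_stepHom_eq (E := []) (by simp [bnd]) θ
  have hle : OrderHom.lfp (stepHom [] θ X e) ≤ θ X :=
    OrderHom.lfp_le _ (by simpa [stepHom_apply, sol] using he)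
  rw [hlfp, ← OrderHom.map_lfp] at hle
  simpa only [stepHom_apply, sol, Expr.eval_update_of_notMem_occ hg] using hle

theorem lfp_eq_of_conditional {f f₂ k : EReal →o EReal} {p : EReal → Prop}
    (hlt : ∀ r, p r → f r = f₂ r) (hge : ∀ r, ¬ p r → f r = f₂ r ⊔ k r)
    (hp : ∀ r, f₂.lfp ≤ r → p r → p f₂.lfp) (hk : f₂ k.lfp ≤ k.lfp) :
    (p f₂.lfp → f.lfp = f₂.lfp) ∧ (¬ p f₂.lfp → f.lfp = k.lfp) := by
  have hf₂ : ∀ r, f₂ r ≤ f r := fun r => by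
    by_cases h : p r
    · exact (hlt r h).ge
    · exact (hge r h).symm ▸ le_sup_left
  have hlow : f₂.lfp ≤ f.lfp :=
    OrderHom.lfp_le _ ((hf₂ _).trans f.map_lfp.le)
  constructor
  · intro h
    exact le_antisymm (OrderHom.lfp_le _ (by rw [hlt _ h, f₂.map_lfp])) hlow
  · intro h
    apply le_antisymm
    · apply OrderHom.lfp_le
      rw [hge _ fun h' => h (hp _ (OrderHom.lfp_le _ hk) h'), k.map_lfp]
      exact sup_le hk le_rfl
    · apply OrderHom.lfp_le
      calc k f.lfp ≤ f₂ f.lfp ⊔ k f.lfp := le_sup_right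
        _ = f f.lfp := (hge _ fun h' => h (hp _ hlow h')).symm
        _ = f.lfp := f.map_lfp

/-- solving `μ X = (e₁ → e₂ ◇ e₃)`. -/
theorem sol_condR_mu (X : V) (e₁ e₂ e₃ g₂ g₂₃ : Expr V)
    (hg₂ : X ∉ g₂.occ) (hg₂₃ : X ∉ g₂₃.occ)
    (h2 : REquiv [(FP.mu, X, e₂)] [(FP.mu, X, g₂)])
    (h23 : REquiv [(FP.mu, X, Expr.emax e₂ e₃)] [(FP.mu, X, g₂₃)]) :
    REquiv [(FP.mu, X, Expr.condR e₁ e₂ e₃)]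
      [(FP.mu, X, Expr.condR (Expr.subst X g₂ e₁) g₂ g₂₃)] := by
  intro F hF η
  have hX : X ∉ bnd F := fun h => by simpa [bnd] using (hF X h).1
  have hsol : ∀ r, sol F (Function.update η X r) X = r := fun r => by
    rw [sol_of_notMem_bnd hX, Function.update_self]
  simp only [List.singleton_append, sol_mu_cons]
  congr 2
  have hm₂ := h2.lfp_stepHom_eq hX η
  have hm₂₃ := h23.lfp_stepHom_eq hX η
  have hpre : stepHom F η X e₂ (stepHom F η X (Expr.emax e₂ e₃)).lfp
      ≤ (stepHom F η X (Expr.emax e₂ e₃)).lfp :=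
    le_sup_left.trans (stepHom F η X (Expr.emax e₂ e₃)).map_lfp.le
  have hpre' : stepHom F η X g₂ (stepHom F η X g₂₃).lfp ≤ (stepHom F η X g₂₃).lfp := by
    rw [← hm₂₃]
    have := h2.eval_le hg₂ (θ := sol F (Function.update η X
      (stepHom F η X (Expr.emax e₂ e₃)).lfp)) (by rw [hsol]; exact hpre)
    rwa [hsol] at this
  have hL := lfp_eq_of_conditional (f := stepHom F η X (Expr.condR e₁ e₂ e₃))
    (f₂ := stepHom F η X e₂) (k := stepHom F η X (Expr.emax e₂ e₃))
    (p := fun r => stepHom F η X e₁ r < 0)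
    (fun r h => if_pos h)
    (fun r h => (if_neg h).trans (sup_left_idem _ _).symm)
    (fun r h hr => ((stepHom F η X e₁).monotone h).trans_lt hr) hpre
  have hR := lfp_eq_of_conditional
    (f := stepHom F η X (Expr.condR (Expr.subst X g₂ e₁) g₂ g₂₃))
    (f₂ := stepHom F η X g₂) (k := stepHom F η X g₂₃)
    (p := fun r => stepHom F η X (Expr.subst X g₂ e₁) r < 0)
    (fun r h => if_pos h) (fun r h => if_neg h)
    (fun r h hr => ((stepHom F η X _).monotone h).trans_lt hr) hpre'
  have hguard : stepHom F η X (Expr.subst X g₂ e₁) (stepHom F η X g₂).lfp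
      = stepHom F η X e₁ (stepHom F η X g₂).lfp := by
    have hfix : Expr.eval (sol F (Function.update η X (stepHom F η X g₂).lfp)) g₂
        = sol F (Function.update η X (stepHom F η X g₂).lfp) X :=
      (stepHom F η X g₂).map_lfp.trans (hsol _).symm
    rw [stepHom_apply, stepHom_apply, Expr.eval_subst, hfix, Function.update_eq_self]
  rw [hm₂, hm₂₃] at hL
  rw [hguard] at hR
  by_cases h : stepHom F η X e₁ (stepHom F η X g₂).lfp < 0
  · exact (hL.1 h).trans (hR.1 h).symm
  · exact (hL.2 h).trans (hR.2 h).symm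

end
end RESpaper
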